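/- Let a: X × X → ℂ be a continuous sesquilinear form on a Hilbert space X with continuity constant C_b, satisfying an inf-sup condition on X with constant β > 0. Let V_h ⊂ X be a closed subspace such that for every v ∈ X the problem a(w_h, R_h v) = a(w_h, v) for all w_h ∈ V_h has a unique solution R_h v ∈ V_h with ‖R_h v‖ ≤ C_F ‖v‖ for a constant C_F independent of v. Then a satisfies the discrete inf-sup condition inf_{w_h ∈ V_h\{0}} sup_{v_h ∈ V_h\{0}} |a(w_h,v_h)| / (‖w_h‖ ‖v_h‖) ≥ β / C_F. -/

import Mathlib

/-- Fortin's trick.  If the continuous sesquilinear form `a` (with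
continuity constant `Cb`) satisfies the inf-sup condition with constant `β > 0` on `X`,
and `Rh : X → Vh` is the adjoint Galerkin projection, i.e.
`a(w_h, Rh v) = a(w_h, v)` for all `w_h ∈ Vh`, with the uniform bound
`‖Rh v‖ ≤ C_F ‖v‖`, then the discrete inf-sup condition holds with constant `β / C_F`. -/
theorem stmt_4 {X : Type*} [NormedAddCommGroup X] [NormedSpace ℂ X]
    (a : X → X → ℂ) (Cb β CF : ℝ) (hCb : 0 < Cb) (hβ : 0 < β) (hCF : 0 < CF)
    (hbound : ∀ w v : X, ‖a w v‖ ≤ Cb * ‖w‖ * ‖v‖)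
    (hinfsup : ∀ w : X, β * ‖w‖ ≤ ⨆ v : X, ‖a w v‖ / ‖v‖)
    (Vh : Submodule ℂ X)
    (Rh : X → X) (hRhmem : ∀ v : X, Rh v ∈ Vh)
    (hfortin : ∀ v : X, ∀ wh ∈ Vh, a wh (Rh v) = a wh v)
    (hRhbound : ∀ v : X, ‖Rh v‖ ≤ CF * ‖v‖) :
    ∀ wh ∈ Vh, (β / CF) * ‖wh‖ ≤ ⨆ vh : Vh, ‖a wh (vh : X)‖ / ‖(vh : X)‖ := by
  intro w hw
  set S : ℝ := ⨆ vh : Vh, ‖a w (vh : X)‖ / ‖(vh : X)‖ with hS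
  have hbdd : BddAbove (Set.range fun vh : Vh => ‖a w (vh : X)‖ / ‖(vh : X)‖) := by
    refine ⟨Cb * ‖w‖, ?_⟩
    rintro _ ⟨v, rfl⟩
    exact div_le_of_le_mul₀ (norm_nonneg _) (by positivity) (hbound w v)
  have hS0 : 0 ≤ S := Real.iSup_nonneg fun v => by positivity
  have key : ∀ x ∈ Vh, ‖a w x‖ ≤ S * ‖x‖ := by
    intro x hx
    rcases eq_or_ne x 0 with rfl | h0
    · simpa using hbound w 0
    · have h := le_ciSup hbdd ⟨x, hx⟩
      exact (div_le_iff₀ (norm_pos_iff.mpr h0)).mp h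
  have hsup : (⨆ v : X, ‖a w v‖ / ‖v‖) ≤ S * CF := by
    refine ciSup_le fun v => ?_
    refine div_le_of_le_mul₀ (norm_nonneg _) (by positivity) ?_
    calc ‖a w v‖ = ‖a w (Rh v)‖ := by rw [hfortin v w hw]
      _ ≤ S * ‖Rh v‖ := key _ (hRhmem v)
      _ ≤ S * (CF * ‖v‖) := mul_le_mul_of_nonneg_left (hRhbound v) hS0
      _ = S * CF * ‖v‖ := by ring
  have h := (hinfsup w).trans hsup
  rw [div_mul_eq_mul_div, div_le_iff₀ hCF]
  exact h
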